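/- Let (Ω, μ) be a finite probability space, let F > 0, R ≥ 0, M ≥ 0 be reals, and let s ≥ 2, l ≥ 1, z ≥ r ≥ 1 be integers. Let W̃, X_1,…,X_s, Z_1,…,Z_z be random variables with finite ranges such that: (i) H(W̃) = (l·s − 1)·F; (ii) H(W̃ | X_1,…,X_s, Z_1,…,Z_z) = 0; (iii) there exist an index j ∈ [s] and a set G ⊆ [z] with |G| = r such that I(W̃; X_j, (Z_c)_{c∈G}) = 0; (iv) H(X_i) ≤ R·F for every i ∈ [s]; and (v) H(Z_c) ≤ M·F for every c ∈ [z]∖G. Then (l·s − 1)·F ≤ (s − 1)·R·F + (z − r)·M·F. -/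

import Mathlib

open Finset

/-- Probability that the finitely-valued random variable `X` takes the value `a`,
on the finite probability space with mass function `μ`. -/
noncomputable def probOf {Ω α : Type} [Fintype Ω] [DecidableEq α]
    (μ : Ω → ℝ) (X : Ω → α) (a : α) : ℝ :=
  ∑ ω ∈ Finset.univ.filter (fun ω => X ω = a), μ ω

/-- Shannon entropy (in bits) of a finitely-valued random variable. -/
noncomputable def shannonH {Ω α : Type} [Fintype Ω] [Fintype α] [DecidableEq α]
    (μ : Ω → ℝ) (X : Ω → α) : ℝ :=
  (∑ a : α, Real.negMulLog (probOf μ X a)) / Real.log 2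

/-- Conditional Shannon entropy `H(X | Y)` (in bits). -/
noncomputable def condH {Ω α β : Type} [Fintype Ω] [Fintype α] [Fintype β]
    [DecidableEq α] [DecidableEq β] (μ : Ω → ℝ) (X : Ω → α) (Y : Ω → β) : ℝ :=
  shannonH μ (fun ω => (X ω, Y ω)) - shannonH μ Y

/-- Mutual information `I(X ; Y)` (in bits). -/
noncomputable def mutInf {Ω α β : Type} [Fintype Ω] [Fintype α] [Fintype β]
    [DecidableEq α] [DecidableEq β] (μ : Ω → ℝ) (X : Ω → α) (Y : Ω → β) : ℝ :=
  shannonH μ X + shannonH μ Y - shannonH μ (fun ω => (X ω, Y ω))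
lemma sum_mul_comp_eq_sum_probOf {Ω α : Type} [Fintype Ω] [Fintype α] [DecidableEq α]
    (μ : Ω → ℝ) (X : Ω → α) (g : α → ℝ) :
    ∑ ω, μ ω * g (X ω) = ∑ a, probOf μ X a * g a := by
  rw [← Finset.sum_fiberwise Finset.univ X]
  refine Finset.sum_congr rfl fun a _ => ?_
  rw [probOf, Finset.sum_mul]
  refine Finset.sum_congr rfl fun ω hω => ?_
  rw [(Finset.mem_filter.1 hω).2]

lemma probOf_nonneg {Ω α : Type} [Fintype Ω] [DecidableEq α] {μ : Ω → ℝ}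
    (hμ : ∀ ω, 0 ≤ μ ω) (X : Ω → α) (a : α) : 0 ≤ probOf μ X a :=
  Finset.sum_nonneg fun ω _ => hμ ω

lemma sum_probOf {Ω α : Type} [Fintype Ω] [Fintype α] [DecidableEq α]
    (μ : Ω → ℝ) (X : Ω → α) : ∑ a, probOf μ X a = ∑ ω, μ ω := by
  simpa using (sum_mul_comp_eq_sum_probOf μ X fun _ => 1).symm

lemma le_probOf_apply {Ω α : Type} [Fintype Ω] [DecidableEq α] {μ : Ω → ℝ}
    (hμ : ∀ ω, 0 ≤ μ ω) (X : Ω → α) (ω : Ω) : μ ω ≤ probOf μ X (X ω) :=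
  Finset.single_le_sum (f := μ) (fun ω _ => hμ ω) (by simp)

/-- Entropy as the expected surprisal. -/
lemma shannonH_eq_sum {Ω α : Type} [Fintype Ω] [Fintype α] [DecidableEq α]
    (μ : Ω → ℝ) (X : Ω → α) :
    shannonH μ X = (∑ ω, μ ω * -Real.log (probOf μ X (X ω))) / Real.log 2 := by
  rw [shannonH, sum_mul_comp_eq_sum_probOf μ X fun a => -Real.log (probOf μ X a)]
  simp only [Real.negMulLog, neg_mul, mul_neg]

/-- Entropy does not increase when passing to a random variable determined by another. -/
lemma shannonH_le_of_determined {Ω α β : Type} [Fintype Ω] [Fintype α] [DecidableEq α]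
    [Fintype β] [DecidableEq β] {μ : Ω → ℝ} (hμ : ∀ ω, 0 ≤ μ ω) (X : Ω → α) (Y : Ω → β)
    (h : ∀ ω ω', Y ω = Y ω' → X ω = X ω') : shannonH μ X ≤ shannonH μ Y := by
  rw [shannonH_eq_sum, shannonH_eq_sum]
  refine div_le_div_of_nonneg_right (Finset.sum_le_sum fun ω _ => ?_)
    (Real.log_pos one_lt_two).le
  rcases (hμ ω).eq_or_lt with h0 | h0
  · simp [← h0]
  · refine mul_le_mul_of_nonneg_left (neg_le_neg (Real.log_le_log
      (h0.trans_le (le_probOf_apply hμ Y ω)) ?_)) h0.le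
    refine Finset.sum_le_sum_of_subset_of_nonneg (fun ω' hω' => ?_) fun ω _ _ => hμ ω
    simp only [Finset.mem_filter, Finset.mem_univ, true_and] at hω' ⊢
    exact h _ _ hω'

/-- Subadditivity of entropy. -/
lemma shannonH_prodMk_le {Ω α β : Type} [Fintype Ω] [Fintype α] [DecidableEq α]
    [Fintype β] [DecidableEq β] {μ : Ω → ℝ} (hμ : ∀ ω, 0 ≤ μ ω) (hμ1 : ∑ ω, μ ω = 1)
    (X : Ω → α) (Y : Ω → β) :
    shannonH μ (fun ω => (X ω, Y ω)) ≤ shannonH μ X + shannonH μ Y := by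
  set V : Ω → α × β := fun ω => (X ω, Y ω) with hV
  rw [shannonH_eq_sum, shannonH_eq_sum, shannonH_eq_sum, ← add_div, ← Finset.sum_add_distrib]
  refine div_le_div_of_nonneg_right ?_ (Real.log_pos one_lt_two).le
  let g : α × β → ℝ := fun p => probOf μ X p.1 * probOf μ Y p.2 / probOf μ V p
  have hterm : ∀ ω, μ ω * -Real.log (probOf μ V (V ω)) + μ ω - μ ω * g (V ω) ≤
      μ ω * -Real.log (probOf μ X (X ω)) + μ ω * -Real.log (probOf μ Y (Y ω)) := by
    intro ω
    rcases (hμ ω).eq_or_lt with h0 | h0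
    · simp [← h0]
    · have hx := h0.trans_le (le_probOf_apply hμ X ω)
      have hy := h0.trans_le (le_probOf_apply hμ Y ω)
      have hv := h0.trans_le (le_probOf_apply hμ V ω)
      have hlog := Real.log_le_sub_one_of_pos (div_pos (mul_pos hx hy) hv)
      rw [Real.log_div (mul_pos hx hy).ne' hv.ne', Real.log_mul hx.ne' hy.ne'] at hlog
      have := mul_le_mul_of_nonneg_left hlog h0.le
      simp only [g, hV] at this ⊢
      linarith
  have hg : ∑ ω, μ ω * g (V ω) ≤ 1 := by
    rw [sum_mul_comp_eq_sum_probOf]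
    calc ∑ p, probOf μ V p * g p
        ≤ ∑ p : α × β, probOf μ X p.1 * probOf μ Y p.2 := by
          refine Finset.sum_le_sum fun p _ => ?_
          rcases eq_or_ne (probOf μ V p) 0 with h0 | h0
          · rw [h0, zero_mul]
            exact mul_nonneg (probOf_nonneg hμ X _) (probOf_nonneg hμ Y _)
          · exact (mul_div_cancel₀ _ h0).le
      _ = 1 := by
          rw [Fintype.sum_prod_type, ← Finset.sum_mul_sum, sum_probOf, sum_probOf, hμ1, one_mul]
  have hsum := Finset.sum_le_sum fun ω (_ : ω ∈ Finset.univ) => hterm ω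
  rw [Finset.sum_sub_distrib, Finset.sum_add_distrib, hμ1] at hsum
  linarith

/-- Adjoining a finite family of random variables raises the entropy by at most the sum
of their entropies. -/
lemma shannonH_prodMk_family_le {Ω β ι : Type} [Fintype Ω] [Fintype β] [DecidableEq β]
    [DecidableEq ι] {α : ι → Type} [∀ i, Fintype (α i)] [∀ i, DecidableEq (α i)]
    {μ : Ω → ℝ} (hμ : ∀ ω, 0 ≤ μ ω) (hμ1 : ∑ ω, μ ω = 1)
    (Y : Ω → β) (U : ∀ i, Ω → α i) (S : Finset ι) :
    shannonH μ (fun ω => (Y ω, fun i : {i // i ∈ S} => U i.1 ω)) ≤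
      shannonH μ Y + ∑ i ∈ S, shannonH μ (U i) := by
  induction S using Finset.induction_on with
  | empty =>
    rw [Finset.sum_empty, add_zero]
    refine shannonH_le_of_determined hμ _ _ fun ω ω' h => Prod.ext h (funext fun i => ?_)
    exact absurd i.2 (Finset.notMem_empty _)
  | insert k S hk ih =>
    rw [Finset.sum_insert hk]
    have hsub := shannonH_prodMk_le hμ hμ1
      (fun ω => (Y ω, fun i : {i // i ∈ S} => U i.1 ω)) (U k)
    refine (shannonH_le_of_determined hμ _ _ fun ω ω' h => ?_).trans
      (hsub.trans (by linarith))
    simp only [Prod.mk.injEq] at h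
    refine Prod.ext h.1.1 (funext fun i => ?_)
    obtain ⟨i, hi⟩ := i
    rcases Finset.mem_insert.1 hi with rfl | hi
    · exact h.2
    · exact congrFun h.1.2 ⟨i, hi⟩

/-- cut-set rate chain, abstract form: on a finite probability
space, if `H(W̃) = (l·s−1)·F`, `W̃` is determined by the `s` transmissions and the
`z` caches, some transmission `X_j` together with the `r` caches in `G` reveals
nothing about `W̃`, each transmission has entropy at most `R·F`, and each cache
outside `G` has entropy at most `M·F`, then `(l·s−1)·F ≤ (s−1)·R·F + (z−r)·M·F`. -/
theorem stmt_3 {Ω : Type} [Fintype Ω] (μ : Ω → ℝ)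
    (hμ0 : ∀ ω, 0 ≤ μ ω) (hμ1 : ∑ ω, μ ω = 1)
    (F R M : ℝ) (hF : 0 < F) (hR : 0 ≤ R) (hM : 0 ≤ M)
    (s l z r : ℕ) (hs : 2 ≤ s) (hl : 1 ≤ l) (hr1 : 1 ≤ r) (hrz : r ≤ z)
    {αW : Type} [Fintype αW] [DecidableEq αW]
    {αX : Fin s → Type} [∀ i, Fintype (αX i)] [∀ i, DecidableEq (αX i)]
    {αZ : Fin z → Type} [∀ c, Fintype (αZ c)] [∀ c, DecidableEq (αZ c)]
    (Wt : Ω → αW) (X : ∀ i, Ω → αX i) (Z : ∀ c, Ω → αZ c)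
    (h1 : shannonH μ Wt = ((l : ℝ) * (s : ℝ) - 1) * F)
    (h2 : condH μ Wt (fun ω => ((fun i => X i ω), (fun c => Z c ω))) = 0)
    (j : Fin s) (G : Finset (Fin z)) (hG : G.card = r)
    (h3 : mutInf μ Wt
            (fun ω => (X j ω, fun c : {c : Fin z // c ∈ G} => Z c.1 ω)) = 0)
    (h4 : ∀ i : Fin s, shannonH μ (X i) ≤ R * F)
    (h5 : ∀ c : Fin z, c ∉ G → shannonH μ (Z c) ≤ M * F) :
    ((l : ℝ) * (s : ℝ) - 1) * F ≤ ((s : ℝ) - 1) * R * F + ((z : ℝ) - (r : ℝ)) * M * F := by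
  have hWA := shannonH_le_of_determined hμ0
    (fun ω => (Wt ω, (X j ω, fun c : {c : Fin z // c ∈ G} => Z c.1 ω)))
    (fun ω => (Wt ω, ((fun i => X i ω), (fun c => Z c ω)))) (by
      intro ω ω' h
      simp only [Prod.mk.injEq] at h ⊢
      exact ⟨h.1, congrFun h.2.1 j, funext fun c => congrFun h.2.2 c.1⟩)
  have hall : shannonH μ (fun ω => ((fun i => X i ω), (fun c => Z c ω))) ≤
      shannonH μ (fun ω => (X j ω, fun c : {c : Fin z // c ∈ G} => Z c.1 ω)) +
        ∑ i ∈ Finset.univ.erase j, shannonH μ (X i) + ∑ c ∈ Gᶜ, shannonH μ (Z c) := by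
    refine (shannonH_le_of_determined hμ0 _ _ ?_).trans
      ((shannonH_prodMk_family_le hμ0 hμ1 _ Z Gᶜ).trans
        (add_le_add_left (shannonH_prodMk_family_le hμ0 hμ1 _ X (Finset.univ.erase j)) _))
    intro ω ω' h
    simp only [Prod.mk.injEq] at h ⊢
    obtain ⟨⟨⟨hj, hG'⟩, hXs⟩, hZs⟩ := h
    refine ⟨funext fun i => ?_, funext fun c => ?_⟩
    · by_cases hi : i = j
      · subst hi
        exact hj
      · exact congrFun hXs ⟨i, by simp [hi]⟩
    · by_cases hc : c ∈ G
      · exact congrFun hG' ⟨c, hc⟩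
      · exact congrFun hZs ⟨c, by simp [hc]⟩
  have hXsum : ∑ i ∈ Finset.univ.erase j, shannonH μ (X i) ≤ ((s : ℝ) - 1) * (R * F) := by
    refine (Finset.sum_le_card_nsmul _ _ _ fun i _ => h4 i).trans_eq ?_
    rw [Finset.card_erase_of_mem (Finset.mem_univ j), Finset.card_univ, Fintype.card_fin,
      nsmul_eq_mul, Nat.cast_sub (by lia), Nat.cast_one]
  have hZsum : ∑ c ∈ Gᶜ, shannonH μ (Z c) ≤ ((z : ℝ) - r) * (M * F) := by
    refine (Finset.sum_le_card_nsmul _ _ _ fun c hc => h5 c (Finset.mem_compl.1 hc)).trans_eq ?_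
    rw [Finset.card_compl, Fintype.card_fin, hG, nsmul_eq_mul, Nat.cast_sub hrz]
  rw [condH] at h2
  rw [mutInf] at h3
  linarith
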